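/- arXiv:math/0503147 — 6 statements merged into one kernel-verified Lean document; each statement's English description precedes it below -/
import Mathlib

section
/- Let V be a finite-dimensional real vector space, and let W, E ⊆ V be subspaces with V = W ⊕ E. Let B be an alternating bilinear form on V* with induced map B♯ : V* → V defined by η(B♯(ξ)) = B(ξ, η). If B♯(E⁰) ⊆ W, then W ∩ B♯(W⁰) = {0}; that is, if w ∈ W and w = B♯(ξ) for some ξ in the annihilator W⁰ of W, then w = 0. -/
/-- Let `V` be a finite-dimensional real vector space, `W, E ⊆ V`
subspaces with `V = W ⊕ E`.  Let `B` be an alternating bilinear form on `V*`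
with induced map `B♯ : V* → V` defined by `η (B♯ ξ) = B ξ η`.  If
`B♯(E⁰) ⊆ W`, then `W ∩ B♯(W⁰) = {0}`: if `w ∈ W` and `w = B♯ ξ` for some
`ξ` in the annihilator `W⁰`, then `w = 0`. -/
theorem stmt_1 (V : Type*) [AddCommGroup V] [Module ℝ V] [FiniteDimensional ℝ V]
    (W E : Submodule ℝ V) (hWE : IsCompl W E)
    (B : Module.Dual ℝ V →ₗ[ℝ] Module.Dual ℝ V →ₗ[ℝ] ℝ)
    (hAlt : ∀ ξ, B ξ ξ = 0)
    (Bsharp : Module.Dual ℝ V →ₗ[ℝ] V)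
    (hBsharp : ∀ ξ η : Module.Dual ℝ V, η (Bsharp ξ) = B ξ η)
    (hmaps : ∀ ξ ∈ E.dualAnnihilator, Bsharp ξ ∈ W) :
    ∀ w ∈ W, ∀ ξ ∈ W.dualAnnihilator, Bsharp ξ = w → w = 0 := by
  rintro w hw ξ hξ rfl
  have hE : Bsharp ξ ∈ E := by
    refine (Subspace.forall_mem_dualAnnihilator_apply_eq_zero_iff E _).1 fun η hη => ?_
    have hvanish : ξ (Bsharp η) = 0 :=
      (Submodule.mem_dualAnnihilator ξ).1 hξ _ (hmaps η hη)
    have hB : LinearMap.IsAlt B := hAlt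
    rw [hBsharp, ← hB.neg, ← hBsharp, hvanish, neg_zero]
  exact Submodule.disjoint_def.1 hWE.disjoint _ hw hE
end

section
/- Let G be a group, V a finite-dimensional real vector space, and ρ : G → GL(V) a linear representation. Let B be an alternating bilinear form on V* which is invariant under the contragredient action, i.e., B(ξ ∘ ρ(g), η ∘ ρ(g)) = B(ξ, η) for all g ∈ G and ξ, η ∈ V*, and let B♯ : V* → V be defined by η(B♯(ξ)) = B(ξ, η). Suppose E ⊆ V is a G-invariant subspace with V = V^G ⊕ E, where V^G is the fixed-point subspace. Then B♯ maps the annihilator E⁰ into V^G. -/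
/-- Let `G` be a group, `V` a finite-dimensional real vector
space, `ρ : G → GL(V)` a representation.  Let `B` be an alternating bilinear
form on `V*` invariant under the contragredient action,
`B (ξ ∘ ρ g) (η ∘ ρ g) = B ξ η`, and let `B♯ : V* → V` be defined by
`η (B♯ ξ) = B ξ η`.  If `E ⊆ V` is a `G`-invariant subspace with
`V = V^G ⊕ E`, then `B♯` maps the annihilator `E⁰` into `V^G`. -/
theorem stmt_3 (G : Type*) [Group G]
    (V : Type*) [AddCommGroup V] [Module ℝ V] [FiniteDimensional ℝ V]
    (ρ : G →* (V ≃ₗ[ℝ] V))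
    (B : Module.Dual ℝ V →ₗ[ℝ] Module.Dual ℝ V →ₗ[ℝ] ℝ)
    (hAlt : ∀ ξ, B ξ ξ = 0)
    (hBinv : ∀ (g : G) (ξ η : Module.Dual ℝ V),
      B (ξ.comp (ρ g : V →ₗ[ℝ] V)) (η.comp (ρ g : V →ₗ[ℝ] V)) = B ξ η)
    (Bsharp : Module.Dual ℝ V →ₗ[ℝ] V)
    (hBsharp : ∀ ξ η : Module.Dual ℝ V, η (Bsharp ξ) = B ξ η)
    (F : Submodule ℝ V) (hF : ∀ v, v ∈ F ↔ ∀ g : G, ρ g v = v)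
    (E : Submodule ℝ V) (hEinv : ∀ (g : G), ∀ v ∈ E, ρ g v ∈ E)
    (hFE : IsCompl F E) :
    ∀ ξ ∈ E.dualAnnihilator, Bsharp ξ ∈ F := by
  intro ξ hξ
  rw [Submodule.mem_dualAnnihilator] at hξ
  rw [hF]
  intro g
  have hinv : ξ.comp (ρ g : V →ₗ[ℝ] V) = ξ := by
    ext v
    obtain ⟨f, hf, e, he, rfl⟩ :=
      Submodule.mem_sup.mp (hFE.sup_eq_top ▸ Submodule.mem_top : v ∈ F ⊔ E)
    simp [(hF f).mp hf g, hξ e he, hξ _ (hEinv g e he)]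
  refine (Module.forall_dual_apply_eq_zero_iff ℝ _).mp (fun η => ?_) |> sub_eq_zero.mp
  have h := hBinv g ξ η
  rw [hinv, ← hBsharp, ← hBsharp] at h
  simpa [sub_eq_zero] using h
end

section
/- Let G be a finite group, V a finite-dimensional real vector space, ρ : G → GL(V) a linear representation, and B an alternating bilinear form on V* invariant under the contragredient action (B(ξ ∘ ρ(g), η ∘ ρ(g)) = B(ξ, η) for all g, ξ, η). Let p = (1/|G|) Σ_{g ∈ G} ρ(g) and E = ker p. Then: (i) V = V^G ⊕ E and E is G-invariant; (ii) B♯(E⁰) ⊆ V^G, where B♯ : V* → V is defined by η(B♯(ξ)) = B(ξ, η); and (iii) B(ξ, η) = 0 for all ξ ∈ E⁰ and η ∈ (V^G)⁰. -/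
/-- The sum of a finite group of linear automorphisms absorbs the action on the right. -/
theorem sum_rep_apply_rep_apply {G k V : Type*} [Group G] [Fintype G] [Semiring k]
    [AddCommMonoid V] [Module k V] (ρ : G →* (V ≃ₗ[k] V)) (g : G) (v : V) :
    ∑ h : G, ρ h (ρ g v) = ∑ h : G, ρ h v :=
  Fintype.sum_equiv (Equiv.mulRight g) _ _ fun h => by simp

/-- The sum of a finite group of linear automorphisms takes values in the fixed vectors. -/
theorem rep_apply_sum_rep_apply {G k V : Type*} [Group G] [Fintype G] [Semiring k]
    [AddCommMonoid V] [Module k V] (ρ : G →* (V ≃ₗ[k] V)) (g : G) (v : V) :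
    ρ g (∑ h : G, ρ h v) = ∑ h : G, ρ h v := by
  rw [map_sum]
  exact Fintype.sum_equiv (Equiv.mulLeft g) _ _ fun h => by simp

/-- Let `G` be a finite group, `V` a finite-dimensional real
vector space, `ρ : G → GL(V)` a representation, and `B` an alternating
bilinear form on `V*` invariant under the contragredient action.  Let
`p = (1/|G|) ∑ g, ρ g` and `E = ker p`.  Then (i) `V = V^G ⊕ E` and `E` is
`G`-invariant; (ii) `B♯(E⁰) ⊆ V^G`; (iii) `B ξ η = 0` for all `ξ ∈ E⁰` and
`η ∈ (V^G)⁰`. -/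
theorem stmt_4 (G : Type*) [Group G] [Fintype G]
    (V : Type*) [AddCommGroup V] [Module ℝ V] [FiniteDimensional ℝ V]
    (ρ : G →* (V ≃ₗ[ℝ] V))
    (B : Module.Dual ℝ V →ₗ[ℝ] Module.Dual ℝ V →ₗ[ℝ] ℝ)
    (hAlt : ∀ ξ, B ξ ξ = 0)
    (hBinv : ∀ (g : G) (ξ η : Module.Dual ℝ V),
      B (ξ.comp (ρ g : V →ₗ[ℝ] V)) (η.comp (ρ g : V →ₗ[ℝ] V)) = B ξ η)
    (Bsharp : Module.Dual ℝ V →ₗ[ℝ] V)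
    (hBsharp : ∀ ξ η : Module.Dual ℝ V, η (Bsharp ξ) = B ξ η)
    (F : Submodule ℝ V) (hF : ∀ v, v ∈ F ↔ ∀ g : G, ρ g v = v)
    (p : V →ₗ[ℝ] V)
    (hp : p = (Fintype.card G : ℝ)⁻¹ • ∑ g : G, (ρ g : V →ₗ[ℝ] V)) :
    (IsCompl F (LinearMap.ker p) ∧
      ∀ (g : G), ∀ v ∈ LinearMap.ker p, ρ g v ∈ LinearMap.ker p) ∧
    (∀ ξ ∈ (LinearMap.ker p).dualAnnihilator, Bsharp ξ ∈ F) ∧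
    (∀ ξ ∈ (LinearMap.ker p).dualAnnihilator,
      ∀ η ∈ F.dualAnnihilator, B ξ η = 0) := by
  have p_apply (v : V) : p v = (Fintype.card G : ℝ)⁻¹ • ∑ g : G, ρ g v := by
    simp [hp, LinearMap.sum_apply]
  have p_rep (g : G) (v : V) : p (ρ g v) = p v := by
    rw [p_apply, p_apply, sum_rep_apply_rep_apply]
  have hproj : LinearMap.IsProj F p := by
    refine ⟨fun v => (hF _).2 fun g => ?_, fun v hv => ?_⟩
    · rw [p_apply, map_smul, rep_apply_sum_rep_apply]
    · rw [p_apply, Finset.sum_congr rfl fun g _ => (hF v).1 hv g, Finset.sum_const,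
        Finset.card_univ, ← Nat.cast_smul_eq_nsmul ℝ,
        inv_smul_smul₀ (Nat.cast_ne_zero.2 Fintype.card_ne_zero)]
  have comp_rep (ξ : Module.Dual ℝ V) (hξ : ξ ∈ (LinearMap.ker p).dualAnnihilator) (g : G) :
      ξ.comp (ρ g : V →ₗ[ℝ] V) = ξ := by
    ext v
    have hv : ρ g v - v ∈ LinearMap.ker p := by
      rw [LinearMap.mem_ker, map_sub, p_rep, sub_self]
    have := (Submodule.mem_dualAnnihilator ξ).1 hξ _ hv
    rwa [map_sub, sub_eq_zero] at this
  have sharp_mem (ξ : Module.Dual ℝ V) (hξ : ξ ∈ (LinearMap.ker p).dualAnnihilator) :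
      Bsharp ξ ∈ F := by
    refine (hF _).2 fun g => sub_eq_zero.1 <| (Module.forall_dual_apply_eq_zero_iff ℝ _).1 fun η => ?_
    have h := hBinv g ξ η
    rw [comp_rep ξ hξ, ← hBsharp, ← hBsharp] at h
    rw [map_sub, sub_eq_zero]
    exact h
  refine ⟨⟨hproj.isCompl, fun g v hv => ?_⟩, sharp_mem, fun ξ hξ η hη => ?_⟩
  · rw [LinearMap.mem_ker, p_rep]
    exact hv
  · rw [← hBsharp]
    exact (Submodule.mem_dualAnnihilator η).1 hη _ (sharp_mem ξ hξ)
end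

section
/- Let V be a finite-dimensional real vector space, ω a nondegenerate alternating bilinear form on V, and φ : V → V a linear involution (φ ∘ φ = id) satisfying ω(φ(u), φ(v)) = ω(u, v) for all u, v ∈ V. Then the restriction of ω to the fixed subspace ker(φ − id) = {v ∈ V : φ(v) = v} is nondegenerate. -/
/-- Let `V` be a finite-dimensional real vector space, `ω` a
nondegenerate alternating bilinear form on `V`, and `φ : V → V` a linear
involution (`φ ∘ φ = id`) with `ω (φ u) (φ v) = ω u v`.  Then the restriction
of `ω` to the fixed subspace `{v : φ v = v}` is nondegenerate. -/
theorem stmt_6 (V : Type*) [AddCommGroup V] [Module ℝ V] [FiniteDimensional ℝ V]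
    (ω : V →ₗ[ℝ] V →ₗ[ℝ] ℝ)
    (hAlt : ∀ v, ω v v = 0)
    (hNondeg : ∀ v : V, (∀ u : V, ω v u = 0) → v = 0)
    (φ : V →ₗ[ℝ] V) (hinv : φ ∘ₗ φ = LinearMap.id)
    (hω : ∀ u v : V, ω (φ u) (φ v) = ω u v) :
    ∀ v : V, φ v = v → (∀ u : V, φ u = u → ω v u = 0) → v = 0 := by
  intro v hv h
  refine hNondeg v fun u => ?_
  have hfix : φ (u + φ u) = u + φ u := by
    rw [map_add, ← LinearMap.comp_apply, hinv, LinearMap.id_apply, add_comm]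
  have hsum := h (u + φ u) hfix
  have hvu := hω v u
  rw [hv] at hvu
  rw [map_add, hvu] at hsum
  linarith
end

section
/- Let n ≥ 0 and let A = (a_{ij}), 0 ≤ i, j ≤ n, be a skew-symmetric real matrix. For r ∈ ℝ^{n+1} with s(r) := Σ_{l=0}^{n} r_l ≠ 0, define μ_i(r) = r_i / s(r) for i = 0, …, n. Then for all such r and all indices i, j: Σ_{k,l=0}^{n} a_{kl} r_k r_l (∂μ_i/∂r_k)(r) (∂μ_j/∂r_l)(r) = ( a_{ij} − Σ_{l=0}^{n} (a_{il} + a_{lj}) μ_l(r) ) μ_i(r) μ_j(r). -/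
open scoped BigOperators

theorem fderiv_apply_div_sum_single {ι : Type*} [Fintype ι] [DecidableEq ι] {r : ι → ℝ}
    (hr : ∑ l, r l ≠ 0) (i k : ι) :
    fderiv ℝ (fun y : ι → ℝ => y i / ∑ m, y m) r (Pi.single k 1) =
      (if i = k then 1 else 0) / ∑ m, r m - r i / (∑ m, r m) ^ 2 := by
  have hi : HasFDerivAt (fun y : ι → ℝ => y i) (ContinuousLinearMap.proj i) r :=
    hasFDerivAt_apply (𝕜 := ℝ) i r
  have hs : HasFDerivAt (fun y : ι → ℝ => ∑ m, y m)
      (∑ m, ContinuousLinearMap.proj (R := ℝ) (φ := fun _ : ι => ℝ) m) r :=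
    HasFDerivAt.fun_sum fun m _ => hasFDerivAt_apply (𝕜 := ℝ) m r
  have h := hi.fun_mul ((hasDerivAt_inv hr).comp_hasFDerivAt r hs)
  simp only [Function.comp_apply, ← div_eq_mul_inv] at h
  rw [h.fderiv]
  simp only [add_apply, smul_apply, sum_apply, ContinuousLinearMap.proj_apply, smul_eq_mul,
    Pi.single_apply, Finset.sum_ite_eq', Finset.mem_univ, if_true]
  ring

theorem sum_sum_mul_mul_eq_zero_of_skew {ι : Type*} [Fintype ι] {A : ι → ι → ℝ}
    (hA : ∀ i j, A i j = -A j i) (r : ι → ℝ) :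
    ∑ k, ∑ l, A k l * r k * r l = 0 := by
  have h : ∑ k, ∑ l, A k l * r k * r l = -∑ k, ∑ l, A k l * r k * r l := by
    conv_lhs => rw [Finset.sum_comm]
    simp only [← Finset.sum_neg_distrib]
    refine Finset.sum_congr rfl fun k _ => Finset.sum_congr rfl fun l _ => ?_
    rw [hA l k]
    ring
  linarith

theorem sum_sum_mul_ite_sub_mul_ite_sub {ι : Type*} [Fintype ι] [DecidableEq ι]
    (B : ι → ι → ℝ) (i j : ι) (s c d : ℝ) :
    ∑ k, ∑ l, B k l * ((if i = k then 1 else 0) / s - c) * ((if j = l then 1 else 0) / s - d) =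
      B i j / s ^ 2 - d / s * ∑ l, B i l - c / s * ∑ k, B k j + c * d * ∑ k, ∑ l, B k l := by
  have h : ∀ k l, B k l * ((if i = k then 1 else 0) / s - c) *
      ((if j = l then 1 else 0) / s - d) =
      (if i = k then (if j = l then B k l / s ^ 2 else 0) else 0)
        - (if i = k then d / s * B k l else 0) - (if j = l then c / s * B k l else 0)
        + c * d * B k l := by
    intro k l
    split_ifs <;> ring
  simp only [h, Finset.sum_add_distrib, Finset.sum_sub_distrib, Finset.mul_sum]
  simp [Finset.sum_ite_irrel]

/-- For a skew-symmetric matrix `A` and `r ∈ ℝ^{n+1}` with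
`s(r) = ∑ rₗ ≠ 0`, define `μᵢ(r) = rᵢ / s(r)`.  Then
`∑ₖₗ aₖₗ rₖ rₗ ∂μᵢ/∂rₖ ∂μⱼ/∂rₗ = (aᵢⱼ − ∑ₗ (aᵢₗ + aₗⱼ) μₗ) μᵢ μⱼ` at `r`. -/
theorem stmt_9 (n : ℕ) (A : Fin (n + 1) → Fin (n + 1) → ℝ)
    (hA : ∀ i j, A i j = -A j i)
    (r : Fin (n + 1) → ℝ) (hr : ∑ l, r l ≠ 0)
    (i j : Fin (n + 1)) :
    (∑ k, ∑ l, A k l * r k * r l *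
        fderiv ℝ (fun y : Fin (n + 1) → ℝ => y i / ∑ m, y m) r (Pi.single k 1) *
        fderiv ℝ (fun y : Fin (n + 1) → ℝ => y j / ∑ m, y m) r (Pi.single l 1)) =
      (A i j - ∑ l, (A i l + A l j) * (r l / ∑ m, r m)) *
        (r i / ∑ m, r m) * (r j / ∑ m, r m) := by
  simp only [fderiv_apply_div_sum_single hr]
  rw [sum_sum_mul_ite_sub_mul_ite_sub (fun k l => A k l * r k * r l),
    sum_sum_mul_mul_eq_zero_of_skew hA]
  have hi : ∑ l, A i l * r i * r l = r i * ∑ l, A i l * r l := by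
    rw [Finset.mul_sum]
    exact Finset.sum_congr rfl fun l _ => by ring
  have hj : ∑ k, A k j * r k * r j = r j * ∑ k, A k j * r k := by
    rw [Finset.mul_sum]
    exact Finset.sum_congr rfl fun k _ => by ring
  have hμ : ∑ l, (A i l + A l j) * (r l / ∑ m, r m) =
      (∑ l, A i l * r l + ∑ l, A l j * r l) / ∑ m, r m := by
    rw [← Finset.sum_add_distrib, Finset.sum_div]
    exact Finset.sum_congr rfl fun l _ => by ring
  rw [hi, hj, hμ]
  field_simp
  ring
end

section
/- Let n ≥ 0 and let A = (a_{ij}), 0 ≤ i, j ≤ n, be a skew-symmetric real matrix. Define π_{ij} : ℝ^{n+1} → ℝ by π_{ij}(μ) = ( a_{ij} − Σ_{l=0}^{n} (a_{il} + a_{lj}) μ_l ) μ_i μ_j, and for smooth f, g : ℝ^{n+1} → ℝ define {f, g}(μ) = Σ_{i,j=0}^{n} π_{ij}(μ) (∂f/∂μ_i)(μ) (∂g/∂μ_j)(μ). Then this bracket satisfies the Jacobi identity: for all smooth f, g, h : ℝ^{n+1} → ℝ and all μ ∈ ℝ^{n+1}, {{f, g}, h}(μ) + {{g, h}, f}(μ)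 + {{h, f}, g}(μ) = 0; hence it defines a Poisson bracket on ℝ^{n+1}. -/
open scoped BigOperators

/-- The coefficients `π_{ij}(μ) = (a_{ij} − ∑ₗ (a_{il} + a_{lj}) μₗ) μᵢ μⱼ`
of the bracket on the simplex. -/
noncomputable def piCoeff {n : ℕ} (A : Fin (n + 1) → Fin (n + 1) → ℝ)
    (μ : Fin (n + 1) → ℝ) (i j : Fin (n + 1)) : ℝ :=
  (A i j - ∑ l, (A i l + A l j) * μ l) * μ i * μ j

/-- The bracket `{f, g}(μ) = ∑ᵢⱼ π_{ij}(μ) ∂f/∂μᵢ ∂g/∂μⱼ` on `ℝ^{n+1}`. -/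
noncomputable def simplexBracket {n : ℕ} (A : Fin (n + 1) → Fin (n + 1) → ℝ)
    (f g : (Fin (n + 1) → ℝ) → ℝ) : (Fin (n + 1) → ℝ) → ℝ :=
  fun μ => ∑ i, ∑ j, piCoeff A μ i j *
    fderiv ℝ f μ (Pi.single i 1) * fderiv ℝ g μ (Pi.single j 1)

/-- The bilinear form attached to a symmetric matrix is symmetric. -/
theorem sum_mul_mul_comm_of_symm {ι : Type*} [Fintype ι] {F : ι → ι → ℝ}
    (hF : ∀ i l, F i l = F l i) (a b : ι → ℝ) :
    ∑ i, ∑ l, F i l * a i * b l = ∑ i, ∑ l, F i l * b i * a l := by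
  rw [Finset.sum_comm]
  refine Finset.sum_congr rfl fun i _ => Finset.sum_congr rfl fun l _ => ?_
  rw [hF l i]
  ring

/-- Pointwise expansion of an iterated bracket with skew coefficients `P`, whose partial
derivatives are `D`, in terms of gradients `f`, `g`, `h` and Hessians `F`, `G`. -/
theorem iterated_bracket_expansion {ι : Type*} [Fintype ι] {P : ι → ι → ℝ}
    (hP : ∀ i j, P i j = -P j i) (D : ι → ι → ι → ℝ) (f g h : ι → ℝ) (F G : ι → ι → ℝ) :
    ∑ l, ∑ k, P l k * (∑ i, ∑ j, (D l i j * f i * g j + P i j * F i l * g j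
        + P i j * f i * G j l)) * h k =
      (∑ i, ∑ j, ∑ k, f i * g j * h k * ∑ l, P l k * D l i j)
      + (∑ i, ∑ l, F i l * (∑ j, P i j * g j) * (∑ k, P l k * h k))
      - ∑ j, ∑ l, G j l * (∑ i, P j i * f i) * (∑ k, P l k * h k) := by
  have hQ : ∑ l, ∑ k, P l k * (∑ i, ∑ j, D l i j * f i * g j) * h k =
      ∑ i, ∑ j, ∑ k, f i * g j * h k * ∑ l, P l k * D l i j := by
    simp only [Finset.mul_sum, Finset.sum_mul]
    calc _ = ∑ l, ∑ i, ∑ j, ∑ k, P l k * (D l i j * f i * g j) * h k := by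
          refine Finset.sum_congr rfl fun l _ => ?_
          rw [Finset.sum_comm]
          exact Finset.sum_congr rfl fun i _ => Finset.sum_comm
      _ = ∑ i, ∑ j, ∑ k, ∑ l, P l k * (D l i j * f i * g j) * h k := by
          rw [Finset.sum_comm]
          refine Finset.sum_congr rfl fun i _ => ?_
          rw [Finset.sum_comm]
          exact Finset.sum_congr rfl fun j _ => Finset.sum_comm
      _ = _ := by
          refine Finset.sum_congr rfl fun i _ => Finset.sum_congr rfl fun j _ =>
            Finset.sum_congr rfl fun k _ => Finset.sum_congr rfl fun l _ => ?_
          ring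
  have hF : ∑ l, ∑ k, P l k * (∑ i, ∑ j, P i j * F i l * g j) * h k =
      ∑ i, ∑ l, F i l * (∑ j, P i j * g j) * (∑ k, P l k * h k) := by
    rw [Finset.sum_comm (s := Finset.univ (α := ι)) (f := fun i l => F i l * _ * _)]
    refine Finset.sum_congr rfl fun l _ => ?_
    rw [← Finset.sum_mul]
    have : ∑ i, ∑ j, P i j * F i l * g j = ∑ i, F i l * ∑ j, P i j * g j := by
      refine Finset.sum_congr rfl fun i _ => ?_
      rw [Finset.mul_sum]
      exact Finset.sum_congr rfl fun j _ => by ring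
    rw [← this, Finset.mul_sum]
    exact Finset.sum_congr rfl fun k _ => by ring
  have hG : ∑ l, ∑ k, P l k * (∑ i, ∑ j, P i j * f i * G j l) * h k =
      -∑ j, ∑ l, G j l * (∑ i, P j i * f i) * (∑ k, P l k * h k) := by
    rw [Finset.sum_comm (s := Finset.univ (α := ι)) (f := fun j l => G j l * _ * _),
      ← Finset.sum_neg_distrib]
    refine Finset.sum_congr rfl fun l _ => ?_
    rw [← Finset.sum_mul]
    have : ∑ i, ∑ j, P i j * f i * G j l = -∑ j, G j l * ∑ i, P j i * f i := by
      rw [Finset.sum_comm, ← Finset.sum_neg_distrib]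
      refine Finset.sum_congr rfl fun j _ => ?_
      rw [Finset.mul_sum, ← Finset.sum_neg_distrib]
      exact Finset.sum_congr rfl fun i _ => by rw [hP i j]; ring
    rw [this, ← neg_mul, Finset.mul_sum]
    exact Finset.sum_congr rfl fun k _ => by ring
  rw [← hQ, sub_eq_add_neg, ← hF, ← hG]
  simp only [Finset.sum_add_distrib, mul_add, add_mul]

/-- The coefficientwise Jacobi condition implies the vanishing of the cyclic sum of iterated
brackets, expressed through gradients and symmetric Hessians. -/
theorem jacobi_of_coeff_jacobi {ι : Type*} [Fintype ι] {P : ι → ι → ℝ}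
    (hP : ∀ i j, P i j = -P j i) {D : ι → ι → ι → ℝ}
    (hD : ∀ i j k, (∑ l, P l k * D l i j) + (∑ l, P l i * D l j k) + ∑ l, P l j * D l k i = 0)
    (f g h : ι → ℝ) {F G H : ι → ι → ℝ} (hF : ∀ i l, F i l = F l i)
    (hG : ∀ i l, G i l = G l i) (hH : ∀ i l, H i l = H l i) :
    (∑ l, ∑ k, P l k * (∑ i, ∑ j, (D l i j * f i * g j + P i j * F i l * g j
        + P i j * f i * G j l)) * h k)
    + (∑ l, ∑ k, P l k * (∑ i, ∑ j, (D l i j * g i * h j + P i j * G i l * h j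
        + P i j * g i * H j l)) * f k)
    + (∑ l, ∑ k, P l k * (∑ i, ∑ j, (D l i j * h i * f j + P i j * H i l * f j
        + P i j * h i * F j l)) * g k) = 0 := by
  simp only [iterated_bracket_expansion hP]
  have h₁ : ∑ i, ∑ j, ∑ k, g i * h j * f k * ∑ l, P l k * D l i j =
      ∑ i, ∑ j, ∑ k, f i * g j * h k * ∑ l, P l i * D l j k := by
    symm
    rw [Finset.sum_comm]
    refine Finset.sum_congr rfl fun j _ => ?_
    rw [Finset.sum_comm]
    refine Finset.sum_congr rfl fun k _ => Finset.sum_congr rfl fun i _ => ?_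
    ring
  have h₂ : ∑ i, ∑ j, ∑ k, h i * f j * g k * ∑ l, P l k * D l i j =
      ∑ i, ∑ j, ∑ k, f i * g j * h k * ∑ l, P l j * D l k i := by
    rw [Finset.sum_comm]
    refine Finset.sum_congr rfl fun i _ => ?_
    rw [Finset.sum_comm]
    refine Finset.sum_congr rfl fun j _ => Finset.sum_congr rfl fun k _ => ?_
    ring
  have hQ : (∑ i, ∑ j, ∑ k, f i * g j * h k * ∑ l, P l k * D l i j)
      + (∑ i, ∑ j, ∑ k, f i * g j * h k * ∑ l, P l i * D l j k)
      + (∑ i, ∑ j, ∑ k, f i * g j * h k * ∑ l, P l j * D l k i) = 0 := by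
    simp only [← Finset.sum_add_distrib, ← mul_add] at hD ⊢
    simp only [hD, mul_zero, Finset.sum_const_zero]
  rw [h₁, h₂, sum_mul_mul_comm_of_symm hF (fun i => ∑ k, P i k * h k),
    sum_mul_mul_comm_of_symm hG (fun i => ∑ k, P i k * h k),
    sum_mul_mul_comm_of_symm hH (fun i => ∑ k, P i k * f k)]
  linarith

section

variable {n : ℕ} {A : Fin (n + 1) → Fin (n + 1) → ℝ}

theorem piCoeff_skew (hA : ∀ i j, A i j = -A j i) (μ : Fin (n + 1) → ℝ) (i j : Fin (n + 1)) :
    piCoeff A μ i j = -piCoeff A μ j i := by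
  have hs : ∑ l, (A j l + A l i) * μ l = -∑ l, (A i l + A l j) * μ l := by
    rw [← Finset.sum_neg_distrib]
    refine Finset.sum_congr rfl fun l _ => ?_
    rw [hA j l, hA l i]
    ring
  rw [piCoeff, piCoeff, hs, hA j i]
  ring

theorem piCoeff_differentiable (A : Fin (n + 1) → Fin (n + 1) → ℝ) (i j : Fin (n + 1)) :
    Differentiable ℝ fun μ => piCoeff A μ i j := by
  unfold piCoeff
  fun_prop

theorem fderiv_piCoeff_single (A : Fin (n + 1) → Fin (n + 1) → ℝ) (μ : Fin (n + 1) → ℝ)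
    (i j l : Fin (n + 1)) :
    fderiv ℝ (fun μ => piCoeff A μ i j) μ (Pi.single l 1) =
      -(A i l + A l j) * μ i * μ j
      + (A i j - ∑ m, (A i m + A m j) * μ m) *
        ((Pi.single l 1 : Fin (n + 1) → ℝ) i * μ j + μ i * (Pi.single l 1 : Fin (n + 1) → ℝ) j) := by
  have hx (m : Fin (n + 1)) : HasFDerivAt (fun μ : Fin (n + 1) → ℝ => μ m)
      (ContinuousLinearMap.proj (R := ℝ) (φ := fun _ => ℝ) m) μ := hasFDerivAt_apply m μ
  have hs := HasFDerivAt.fun_sum (u := Finset.univ)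
    fun m _ => (hx m).const_mul (A i m + A m j)
  have h := ((hs.const_sub (A i j)).mul (hx i)).mul (hx j)
  rw [show fderiv ℝ (fun μ => piCoeff A μ i j) μ = _ from h.fderiv]
  simp [Pi.single_apply]
  split_ifs <;> ring

/-- The Jacobi identity for the coordinate functions. -/
theorem piCoeff_jacobi (hA : ∀ i j, A i j = -A j i) (μ : Fin (n + 1) → ℝ)
    (i j k : Fin (n + 1)) :
    (∑ l, piCoeff A μ l k * fderiv ℝ (fun μ => piCoeff A μ i j) μ (Pi.single l 1))
    + (∑ l, piCoeff A μ l i * fderiv ℝ (fun μ => piCoeff A μ j k) μ (Pi.single l 1))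
    + ∑ l, piCoeff A μ l j * fderiv ℝ (fun μ => piCoeff A μ k i) μ (Pi.single l 1) = 0 := by
  set b : Fin (n + 1) → ℝ := fun i => ∑ l, A i l * μ l with hb
  have hc (i j) : A i j - ∑ l, (A i l + A l j) * μ l = A i j - b i + b j := by
    have : ∑ l, A l j * μ l = -b j := by
      rw [hb, ← Finset.sum_neg_distrib]
      exact Finset.sum_congr rfl fun l _ => by rw [hA l j]; ring
    simp only [add_mul, Finset.sum_add_distrib, this, hb]
    ring
  set S : Fin (n + 1) → Fin (n + 1) → ℝ := fun i k => ∑ l, A i l * A l k * μ l with hS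
  have hSs (i k) : S i k = S k i :=
    Finset.sum_congr rfl fun l _ => by rw [hA i l, hA l k]; ring
  set T : Fin (n + 1) → ℝ := fun i => ∑ l, A i l * b l * μ l with hT
  have key (i j k) :
      ∑ l, piCoeff A μ l k * fderiv ℝ (fun μ => piCoeff A μ i j) μ (Pi.single l 1) =
      μ i * μ j * μ k * (S j k - T j + b j * b k - (S i k - T i + b i * b k)
        + (A i j - b i + b j) * ((A i k - b i + b k) + (A j k - b j + b k))) := by
    have hd (i k) : S i k - T i + b i * b k = ∑ l, A i l * μ l * (A l k - b l + b k) := by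
      have : b i * b k = ∑ l, A i l * μ l * b k := by rw [← Finset.sum_mul]
      rw [this, hS, hT, ← Finset.sum_sub_distrib, ← Finset.sum_add_distrib]
      exact Finset.sum_congr rfl fun l _ => by ring
    have hδ (m) (r : ℝ) : (A m k - b m + b k) * μ m * μ k * r =
        ∑ l, (A l k - b l + b k) * μ l * μ k * (r * (Pi.single l 1 : Fin (n + 1) → ℝ) m) := by
      simp [Pi.single_apply]
    have e₁ := hδ i ((A i j - b i + b j) * μ j)
    have e₂ := hδ j ((A i j - b i + b j) * μ i)
    rw [hd, hd]
    trans μ i * μ j * μ k * (∑ l, A j l * μ l * (A l k - b l + b k)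
        - ∑ l, A i l * μ l * (A l k - b l + b k))
      + ((A i k - b i + b k) * μ i * μ k * ((A i j - b i + b j) * μ j)
        + (A j k - b j + b k) * μ j * μ k * ((A i j - b i + b j) * μ i))
    · rw [e₁, e₂, ← Finset.sum_sub_distrib, Finset.mul_sum, ← Finset.sum_add_distrib,
        ← Finset.sum_add_distrib]
      refine Finset.sum_congr rfl fun l _ => ?_
      rw [fderiv_piCoeff_single, piCoeff, hc, hc, hA l j]
      ring
    · ring
  rw [key, key, key, hSs k j, hSs k i, hSs j i, hA k j, hA k i, hA j i]
  ring

theorem fderiv_simplexBracket_single (A : Fin (n + 1) → Fin (n + 1) → ℝ)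
    {f g : (Fin (n + 1) → ℝ) → ℝ} (hf : ContDiff ℝ 2 f) (hg : ContDiff ℝ 2 g)
    (μ : Fin (n + 1) → ℝ) (l : Fin (n + 1)) :
    fderiv ℝ (simplexBracket A f g) μ (Pi.single l 1) =
      ∑ i, ∑ j, (fderiv ℝ (fun μ => piCoeff A μ i j) μ (Pi.single l 1)
          * fderiv ℝ f μ (Pi.single i 1) * fderiv ℝ g μ (Pi.single j 1)
        + piCoeff A μ i j * fderiv ℝ (fderiv ℝ f) μ (Pi.single l 1) (Pi.single i 1)
          * fderiv ℝ g μ (Pi.single j 1)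
        + piCoeff A μ i j * fderiv ℝ f μ (Pi.single i 1)
          * fderiv ℝ (fderiv ℝ g) μ (Pi.single l 1) (Pi.single j 1)) := by
  have hd {f : (Fin (n + 1) → ℝ) → ℝ} (hf : ContDiff ℝ 2 f) (i : Fin (n + 1)) :=
    (((hf.fderiv_right (m := 1) (by norm_num)).differentiable (by norm_num)) μ).hasFDerivAt.clm_apply
      (hasFDerivAt_const (Pi.single i (1 : ℝ) : Fin (n + 1) → ℝ) μ)
  have h := HasFDerivAt.fun_sum (u := Finset.univ) fun i _ =>
    HasFDerivAt.fun_sum (u := Finset.univ) fun j _ =>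
      ((piCoeff_differentiable A i j μ).hasFDerivAt.mul (hd hf i)).mul (hd hg j)
  rw [show fderiv ℝ (simplexBracket A f g) μ = _ from h.fderiv]
  simp only [sum_apply]
  refine Finset.sum_congr rfl fun i _ => Finset.sum_congr rfl fun j _ => ?_
  simp
  ring

theorem fderiv_fderiv_comm_of_contDiff {E : Type*} [NormedAddCommGroup E] [NormedSpace ℝ E]
    {f : E → ℝ} (hf : ContDiff ℝ 2 f) (x v w : E) :
    fderiv ℝ (fderiv ℝ f) x v w = fderiv ℝ (fderiv ℝ f) x w v :=
  (hf.contDiffAt.isSymmSndFDerivAt (by simp)).eq v w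

end

/-- For a skew-symmetric matrix `A`, the bracket with
coefficients `π_{ij}(μ) = (a_{ij} − ∑ₗ (a_{il} + a_{lj}) μₗ) μᵢ μⱼ` satisfies
the Jacobi identity on smooth functions, hence defines a Poisson bracket on
`ℝ^{n+1}`. -/
theorem stmt_10 (n : ℕ) (A : Fin (n + 1) → Fin (n + 1) → ℝ)
    (hA : ∀ i j, A i j = -A j i)
    (f g h : (Fin (n + 1) → ℝ) → ℝ)
    (hf : ContDiff ℝ (⊤ : ℕ∞) f) (hg : ContDiff ℝ (⊤ : ℕ∞) g) (hh : ContDiff ℝ (⊤ : ℕ∞) h)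
    (μ : Fin (n + 1) → ℝ) :
    simplexBracket A (simplexBracket A f g) h μ +
      simplexBracket A (simplexBracket A g h) f μ +
      simplexBracket A (simplexBracket A h f) g μ = 0 := by
  have hf₂ : ContDiff ℝ 2 f := contDiff_infty.mp hf 2
  have hg₂ : ContDiff ℝ 2 g := contDiff_infty.mp hg 2
  have hh₂ : ContDiff ℝ 2 h := contDiff_infty.mp hh 2
  have expand (u v : (Fin (n + 1) → ℝ) → ℝ) : simplexBracket A u v μ =
    ∑ i, ∑ j, piCoeff A μ i j * fderiv ℝ u μ (Pi.single i 1) * fderiv ℝ v μ (Pi.single j 1) := rfl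
  simp only [expand, fderiv_simplexBracket_single A hf₂ hg₂, fderiv_simplexBracket_single A hg₂ hh₂,
    fderiv_simplexBracket_single A hh₂ hf₂]
  exact jacobi_of_coeff_jacobi (piCoeff_skew hA μ) (piCoeff_jacobi hA μ)
    (fun i => fderiv ℝ f μ (Pi.single i 1)) (fun i => fderiv ℝ g μ (Pi.single i 1))
    (fun i => fderiv ℝ h μ (Pi.single i 1))
    (F := fun i l => fderiv ℝ (fderiv ℝ f) μ (Pi.single l 1) (Pi.single i 1))
    (G := fun i l => fderiv ℝ (fderiv ℝ g) μ (Pi.single l 1) (Pi.single i 1))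
    (H := fun i l => fderiv ℝ (fderiv ℝ h) μ (Pi.single l 1) (Pi.single i 1))
    (fun _ _ => fderiv_fderiv_comm_of_contDiff hf₂ _ _ _)
    (fun _ _ => fderiv_fderiv_comm_of_contDiff hg₂ _ _ _)
    (fun _ _ => fderiv_fderiv_comm_of_contDiff hh₂ _ _ _)
end
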